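/- arXiv:2508.06618 — 2 statements merged into one kernel-verified Lean document; each statement's English description precedes it below -/
import Mathlib

section
/- There exists an injective map f from the vertex set of the generalized Petersen graph GP(8,3) into the Euclidean plane ℝ² such that for every pair of distinct vertices u, v, the Euclidean distance between f(u) and f(v) equals 1 if and only if u and v are adjacent in GP(8,3). In other words, the Möbius–Kantor graph GP(8,3) admits a faithful unit-distance representation in the plane. -/
noncomputable section

def mobiusKantor : SimpleGraph (Fin 16) :=
  SimpleGraph.fromRel (fun u v =>
    (u.val < 8 ∧ v.val < 8 ∧ (u.val + 1) % 8 = v.val) ∨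
    (u.val < 8 ∧ v.val = u.val + 8) ∨
    (8 ≤ u.val ∧ 8 ≤ v.val ∧ 8 + ((u.val - 8) + 3) % 8 = v.val))

/-- Circumcenter computation: if the circumradius is one, there is a point at distance one
from `(-a,0)`, `(0,d)` and `(x,y)`. -/
lemma mk_circ (a d x y : ℝ) (hc : a * y - d * (x + a) ≠ 0)
    (h : (a^2+d^2) * ((x+a)^2+y^2) * (x^2+(y-d)^2) = 4 * (a * y - d * (x + a))^2)
    (z w : ℝ)
    (hz : (z + a) * (2 * (a * y - d * (x + a))) = y * (a^2+d^2) - d * ((x+a)^2+y^2))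
    (hw : w * (2 * (a * y - d * (x + a))) = a * ((x+a)^2+y^2) - (x+a) * (a^2+d^2)) :
    (z + a)^2 + w^2 = 1 ∧ z^2 + (w - d)^2 = 1 ∧ (x - z)^2 + (y - w)^2 = 1 := by
  have hD : (2 * (a * y - d * (x + a)))^2 ≠ 0 := by positivity
  have h1 : (z + a)^2 + w^2 = 1 := by
    apply mul_right_cancel₀ hD
    have e : ((z + a)^2 + w^2) * (2 * (a * y - d * (x + a)))^2
      = ((z + a) * (2 * (a * y - d * (x + a))))^2 + (w * (2 * (a * y - d * (x + a))))^2 := by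
      ring
    rw [e, hz, hw]
    linear_combination h
  have h2 : 2 * (z + a) * a + 2 * w * d = a^2 + d^2 := by
    apply mul_right_cancel₀ hc
    linear_combination a * hz + d * hw
  have h3 : 2 * (z + a) * (x + a) + 2 * w * y = (x+a)^2 + y^2 := by
    apply mul_right_cancel₀ hc
    linear_combination (x + a) * hz + y * hw
  refine ⟨h1, ?_, ?_⟩
  · linear_combination h1 - h2
  · linear_combination h1 - h3

lemma mk_root : ∃ a d : ℝ, (a + 1/5)^2 + (d - 2/5)^2 = 1 ∧
    0.070079 ≤ a ∧ a ≤ 0.070081 ∧ -0.562839 ≤ d ∧ d ≤ -0.562837 ∧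
    (a^2+d^2) * ((2*a+1/5)^2+9/25) * ((a+1/5)^2+(3/5-d)^2)
      = 4 * (a * (3/5) - d * (2*a+1/5))^2 := by
  let A : ℝ → ℝ := fun t => (1 - t^2) / (1 + t^2) - 1/5
  let D : ℝ → ℝ := fun t => 2 * t / (1 + t^2) + 2/5
  have hp : ∀ t : ℝ, (1 + t^2) ≠ 0 := fun t => by positivity
  have cA : Continuous A := by
    apply Continuous.sub _ continuous_const
    exact Continuous.div (by fun_prop) (by fun_prop) hp
  have cD : Continuous D := by
    apply Continuous.add _ continuous_const
    exact Continuous.div (by fun_prop) (by fun_prop) hp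
  let G : ℝ → ℝ := fun t => ((A t)^2+(D t)^2) * ((2*A t+1/5)^2+9/25) * ((A t+1/5)^2+(3/5-D t)^2)
      - 4 * (A t * (3/5) - D t * (2*A t+1/5))^2
  have cG : Continuous G := by fun_prop
  have hlo : 0 ≤ G (-0.758093) := by simp only [G, A, D]; norm_num
  have hhi : G (-0.758092) ≤ 0 := by simp only [G, A, D]; norm_num
  obtain ⟨t, ⟨ht1, ht2⟩, ht⟩ := intermediate_value_Icc' (by norm_num) cG.continuousOn
    (show (0:ℝ) ∈ Set.Icc (G (-0.758092)) (G (-0.758093)) from ⟨hhi, hlo⟩)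
  have hpos : 0 < 1 + t^2 := by positivity
  refine ⟨A t, D t, ?_, ?_, ?_, ?_, ?_, ?_⟩
  · simp only [A, D]; field_simp; ring
  · have : (0.270079:ℝ) ≤ (1 - t^2) / (1 + t^2) := by rw [le_div_iff₀ hpos]; nlinarith
    simp only [A]; linarith
  · have : (1 - t^2) / (1 + t^2) ≤ (0.270081:ℝ) := by rw [div_le_iff₀ hpos]; nlinarith
    simp only [A]; linarith
  · have : (-0.962839:ℝ) ≤ 2 * t / (1 + t^2) := by rw [le_div_iff₀ hpos]; nlinarith
    simp only [D]; linarith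
  · have : 2 * t / (1 + t^2) ≤ (-0.962837:ℝ) := by rw [div_le_iff₀ hpos]; nlinarith
    simp only [D]; linarith
  · simp only [G] at ht; linarith

lemma mk_points : ∃ a d z w : ℝ, (a + 1/5)^2 + (d - 2/5)^2 = 1 ∧
    (z + a)^2 + w^2 = 1 ∧ z^2 + (w - d)^2 = 1 ∧ (a + 1/5 - z)^2 + (3/5 - w)^2 = 1 ∧
    |a * 1000 - 70| ≤ 1 ∧ |d * 1000 + 563| ≤ 1 ∧ |z * 1000 - 917| ≤ 1 ∧
    |w * 1000 + 163| ≤ 1 := by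
  obtain ⟨a, d, h1, ha1, ha2, hd1, hd2, h⟩ := mk_root
  obtain ⟨C, hC⟩ : ∃ C, C = a * (3/5) - d * (a + 1/5 + a) := ⟨_, rfl⟩
  obtain ⟨L, hL⟩ : ∃ L, L = a^2 + d^2 := ⟨_, rfl⟩
  obtain ⟨M, hM⟩ : ∃ M, M = (a+1/5+a)^2 + (3/5:ℝ)^2 := ⟨_, rfl⟩
  have hC1 : 0.23350 ≤ C := by rw [hC]; nlinarith
  have hC2 : C ≤ 0.233506 := by rw [hC]; nlinarith
  have hL1 : 0.321694 ≤ L := by rw [hL]; nlinarith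
  have hL2 : L ≤ 0.321701 := by rw [hL]; nlinarith
  have hM1 : 0.475705 ≤ M := by rw [hM]; nlinarith
  have hM2 : M ≤ 0.475713 := by rw [hM]; nlinarith
  have hC0 : 0 < 2 * C := by linarith
  obtain ⟨Z, hZ⟩ : ∃ Z, Z = ((3/5) * L - d * M) / (2 * C) := ⟨_, rfl⟩
  obtain ⟨w, hw⟩ : ∃ w, w = (a * M - (a + 1/5 + a) * L) / (2 * C) := ⟨_, rfl⟩
  have eZ : Z * (2 * C) = (3/5) * L - d * M := by rw [hZ]; field_simp
  have ew : w * (2 * C) = a * M - (a + 1/5 + a) * L := by rw [hw]; field_simp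
  have key := mk_circ a d (a + 1/5) (3/5) (by rw [← hC]; linarith)
    (by linear_combination h) (Z - a) w
    (by rw [← hC, ← hL, ← hM]; linear_combination eZ)
    (by rw [← hC, ← hL, ← hM]; linear_combination ew)
  have p1 := mul_nonneg (sub_nonneg.2 hM1) (sub_nonneg.2 hd2)
  have p2 := mul_nonneg (sub_nonneg.2 hM2) (sub_nonneg.2 hd2)
  have p3 := mul_nonneg (sub_nonneg.2 hM1) (sub_nonneg.2 ha1)
  have p4 := mul_nonneg (sub_nonneg.2 hM1) (sub_nonneg.2 ha2)
  have p5 := mul_nonneg (sub_nonneg.2 hL1) (sub_nonneg.2 ha1)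
  have p6 := mul_nonneg (sub_nonneg.2 hL1) (sub_nonneg.2 ha2)
  have hZ1 : 0.9862 ≤ Z := by rw [hZ, le_div_iff₀ hC0]; linarith
  have hZ2 : Z ≤ 0.9870 := by rw [hZ, div_le_iff₀ hC0]; linarith
  have hw1 : -0.1635 ≤ w := by rw [hw, le_div_iff₀ hC0]; linarith
  have hw2 : w ≤ -0.1625 := by rw [hw, div_le_iff₀ hC0]; linarith
  refine ⟨a, d, Z - a, w, h1, key.1, key.2.1, key.2.2, ?_, ?_, ?_, ?_⟩ <;>
    rw [abs_le] <;> constructor <;> linarith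

/-- Approximate coordinates, scaled by 1000. -/
def mkX : Fin 16 → ℤ :=
  ![70, 1070, 270, 917, -70, -1070, -270, -917, -917, 270, 0, 0, 917, -270, 0, 0]

/-- Approximate coordinates, scaled by 1000. -/
def mkY : Fin 16 → ℤ :=
  ![0, 0, 600, -163, 0, 0, -600, 163, -163, -600, 1563, -563, 163, 600, -1563, 563]

instance mkDec : DecidableRel mobiusKantor.Adj := by
  unfold mobiusKantor
  infer_instance

lemma mk_far : ∀ u v : Fin 16, u ≠ v →
    16000 < (mkX u - mkX v)^2 + (mkY u - mkY v)^2 ∧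
    (¬ mobiusKantor.Adj u v →
      (mkX u - mkX v)^2 + (mkY u - mkY v)^2 < 950000 ∨
      1050000 < (mkX u - mkX v)^2 + (mkY u - mkY v)^2) ∧
    |mkX u - mkX v| ≤ 2500 ∧ |mkY u - mkY v| ≤ 3200 := by
  decide +kernel

/-- Perturbation bound for a squared coordinate difference. -/
lemma mk_pert (δ p B : ℝ) (hδ : |δ| ≤ B) (h : |p - δ| ≤ 2) : |p^2 - δ^2| ≤ 4 * B + 4 := by
  have e : p^2 - δ^2 = (p - δ) * (2 * δ + (p - δ)) := by ring
  rw [e, abs_mul]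
  have h2 : |2 * δ + (p - δ)| ≤ 2 * B + 2 := by
    refine (abs_add_le _ _).trans ?_
    rw [abs_mul, abs_two]
    linarith
  calc |p - δ| * |2 * δ + (p - δ)| ≤ 2 * (2 * B + 2) :=
        mul_le_mul h h2 (abs_nonneg _) (by norm_num)
    _ = 4 * B + 4 := by ring

theorem mobiusKantor_faithful_unit_distance :
    ∃ f : Fin 16 → EuclideanSpace ℝ (Fin 2), Function.Injective f ∧
      ∀ u v : Fin 16, u ≠ v → (dist (f u) (f v) = 1 ↔ mobiusKantor.Adj u v) := by
  obtain ⟨a, d, z, w, e1, e2, e3, e4, ha, hd, hz, hw⟩ := mk_points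
  let X : Fin 16 → ℝ := ![a, a + 1, a + 1/5, z, -a, -(a + 1), -(a + 1/5), -z,
    -z, a + 1/5, 0, 0, z, -(a + 1/5), 0, 0]
  let Y : Fin 16 → ℝ := ![0, 0, 3/5, w, 0, 0, -(3/5), -w,
    w, -(3/5), 1 - d, d, -w, 3/5, -(1 - d), -d]
  have hX : ∀ i, |X i * 1000 - mkX i| ≤ 1 := by
    rw [abs_le] at ha hz
    intro i
    fin_cases i <;> simp [X, mkX] <;> rw [abs_le] <;> constructor <;> linarith
  have hY : ∀ i, |Y i * 1000 - mkY i| ≤ 1 := by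
    rw [abs_le] at hd hw
    intro i
    fin_cases i <;> simp [Y, mkY] <;> rw [abs_le] <;> constructor <;> linarith
  have hXd : ∀ u v, |(X u - X v) * 1000 - (mkX u - mkX v)| ≤ 2 := by
    intro u v
    have h1 := abs_le.1 (hX u)
    have h2 := abs_le.1 (hX v)
    rw [abs_le]; constructor <;> linarith
  have hYd : ∀ u v, |(Y u - Y v) * 1000 - (mkY u - mkY v)| ≤ 2 := by
    intro u v
    have h1 := abs_le.1 (hY u)
    have h2 := abs_le.1 (hY v)
    rw [abs_le]; constructor <;> linarith
  -- the squared distance is close to the approximate one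
  have close : ∀ u v, u ≠ v →
      |1000000 * ((X u - X v)^2 + (Y u - Y v)^2)
        - (((mkX u - mkX v)^2 + (mkY u - mkY v)^2 : ℤ) : ℝ)| ≤ 22808 := by
    intro u v huv
    obtain ⟨-, -, bx, bY⟩ := mk_far u v huv
    have bdX : |((mkX u : ℝ) - mkX v)| ≤ 2500 := by exact_mod_cast bx
    have bdY : |((mkY u : ℝ) - mkY v)| ≤ 3200 := by exact_mod_cast bY
    have h1 := abs_le.1 (mk_pert _ _ _ bdX (hXd u v))
    have h2 := abs_le.1 (mk_pert _ _ _ bdY (hYd u v))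
    push_cast
    rw [abs_le]; constructor <;> nlinarith only [h1, h2]
  -- edges
  have edge : ∀ u v : Fin 16, ((u.val < 8 ∧ v.val < 8 ∧ (u.val + 1) % 8 = v.val) ∨
    (u.val < 8 ∧ v.val = u.val + 8) ∨
    (8 ≤ u.val ∧ 8 ≤ v.val ∧ 8 + ((u.val - 8) + 3) % 8 = v.val)) →
      (X u - X v)^2 + (Y u - Y v)^2 = 1 := by
    intro u v h
    have hv : v = ⟨(u.val + 1) % 8, by omega⟩ ∧ u.val < 8 ∨
        v = ⟨(u.val + 8) % 16, by omega⟩ ∧ u.val < 8 ∨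
        v = ⟨8 + (u.val + 3) % 8, by omega⟩ ∧ 8 ≤ u.val := by
      simp only [Fin.ext_iff]
      omega
    clear h
    rcases hv with ⟨rfl, hu⟩ | ⟨rfl, hu⟩ | ⟨rfl, hu⟩ <;> fin_cases u <;>
      first
      | (exfalso; revert hu; decide)
      | (simp [X, Y]; done)
      | (simp [X, Y]; linarith only [e1, e2, e3, e4])
      | (simp [X, Y]; left; linarith only)
      | (simp [X, Y]; right; linarith only)
  have hdist : ∀ u v, dist (!₂[X u, Y u] : EuclideanSpace ℝ (Fin 2)) !₂[X v, Y v] = 1 ↔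
      (X u - X v)^2 + (Y u - Y v)^2 = 1 := by
    intro u v
    rw [EuclideanSpace.dist_eq, Real.sqrt_eq_one]
    simp [Fin.sum_univ_two, Real.dist_eq, sq_abs]
  refine ⟨fun i => !₂[X i, Y i], ?_, ?_⟩
  · intro u v huv
    by_contra hne
    have hx : X u = X v := by
      simpa using congrArg (fun p : EuclideanSpace ℝ (Fin 2) => p 0) huv
    have hy : Y u = Y v := by
      simpa using congrArg (fun p : EuclideanSpace ℝ (Fin 2) => p 1) huv
    have f1 := hXd u v
    have f2 := hYd u v
    rw [hx, sub_self, zero_mul, zero_sub, abs_neg] at f1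
    rw [hy, sub_self, zero_mul, zero_sub, abs_neg] at f2
    have f1' : |mkX u - mkX v| ≤ 2 := by exact_mod_cast f1
    have f2' : |mkY u - mkY v| ≤ 2 := by exact_mod_cast f2
    have f3 := (mk_far u v hne).1
    rw [abs_le] at f1' f2'
    nlinarith
  · intro u v hne
    rw [hdist]
    constructor
    · intro h
      by_contra hadj
      have hc := abs_le.1 (close u v hne)
      rw [h] at hc
      rcases (mk_far u v hne).2.1 hadj with h' | h'
      · have h'' : (((mkX u - mkX v)^2 + (mkY u - mkY v)^2 : ℤ) : ℝ) < 950000 := by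
          exact_mod_cast h'
        linarith
      · have h'' : (1050000 : ℝ) < (((mkX u - mkX v)^2 + (mkY u - mkY v)^2 : ℤ) : ℝ) := by
          exact_mod_cast h'
        linarith
    · intro h
      rw [mobiusKantor, SimpleGraph.fromRel_adj] at h
      rcases h.2 with h | h
      · exact edge u v h
      · have := edge v u h
        linarith
end
end

section
/- There exist two disjoint sets P and C of points in the Euclidean plane ℝ², each of cardinality 8, such that: (i) every point of P is at Euclidean distance exactly 1 from exactly three points of C, (ii) every point of C is at Euclidean distance exactly 1 from exactly three points of P, and (iii) the bipartite graph on P ∪ C in which p ∈ P is joined to c ∈ C exactly when the distance between p and c is 1 is isomorphic to the generalized Petersen graph GP(8,3). Interpreting the points of C as centres of unit circles, this is an isometric point-circle realization of the Möbius–Kantor (8₃) configuration with no false incidences. -/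
noncomputable section

namespace MKaux

/-- The number `√3`. -/
def r : ℝ := √3

/-- The number `√(√3 / 2)`. -/
def w : ℝ := √(r / 2)

lemma r_sq : r * r = 3 := Real.mul_self_sqrt (by norm_num)

lemma r_lo : 17320 / 10000 < r := Real.lt_sqrt_of_sq_lt (by norm_num)

lemma r_hi : r < 17321 / 10000 := (Real.sqrt_lt' (by norm_num)).2 (by norm_num)

lemma w_sq : w * w = r / 2 := Real.mul_self_sqrt (by linarith [r_lo])

lemma w_lo : 9305 / 10000 < w := Real.lt_sqrt_of_sq_lt (by linarith [r_lo])

lemma w_hi : w < 9307 / 10000 :=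
  (Real.sqrt_lt' (by norm_num)).2 (by linarith [r_hi])

lemma rw_lo : 16116 / 10000 < r * w := by nlinarith [r_lo, w_lo]

lemma rw_hi : r * w < 16121 / 10000 := by nlinarith [r_hi, w_hi, r_lo, w_lo]

/-- Abscissa `s` of vertex 0; the representation has the symmetry of a rectangle. -/
def s : ℝ := -1 / 4 - r / 4 + r * w / 2
def q : ℝ := 3 / 4 - r / 4 + w / 2
def v : ℝ := 3 / 4 - r / 4 - w / 2

def px : Fin 16 → ℝ :=
  ![s, s + 1, 1 / 2, r / 2, -s, -s - 1, -1 / 2, -r / 2,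
    -r / 2, 1 / 2, 0, 0, r / 2, -1 / 2, 0, 0]

def py : Fin 16 → ℝ :=
  ![0, 0, q, v, 0, 0, -q, -v,
    v, -q, q + r / 2, v - 1 / 2, -v, q, -q - r / 2, 1 / 2 - v]

def pt (i : Fin 16) : EuclideanSpace ℝ (Fin 2) := !₂[px i, py i]

/-- The adjacency relation as a Boolean-valued function. -/
def adj (u v : Fin 16) : Bool :=
  let e : ℕ → ℕ → Bool := fun u v =>
    (u < 8 && v < 8 && (u + 1) % 8 == v) || (u < 8 && v == u + 8) ||
    (8 ≤ u && 8 ≤ v && 8 + ((u - 8) + 3) % 8 == v)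
  e u.val v.val || e v.val u.val

/-- The bipartition class. -/
def sd (u : Fin 16) : Bool := (u.val + u.val / 8) % 2 == 0

lemma adj_symm : ∀ i j, adj i j = adj j i := by decide

lemma adj_sd : ∀ i j, adj i j = true → sd i ≠ sd j := by decide

lemma mk_adj (i j : Fin 16) : mobiusKantor.Adj i j ↔ adj i j = true := by
  unfold mobiusKantor
  rw [SimpleGraph.fromRel_adj]
  revert i j
  decide

lemma dist_iff (i j : Fin 16) :
    dist (pt i) (pt j) = 1 ↔ (px i - px j) ^ 2 + (py i - py j) ^ 2 = 1 := by
  rw [EuclideanSpace.dist_eq, Real.sqrt_eq_one, Fin.sum_univ_two]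
  simp [pt, Real.dist_eq, sq_abs]

set_option maxHeartbeats 4000000 in
lemma pt_dist (i j : Fin 16) (hi : sd i = true) (hj : sd j = false) :
    dist (pt i) (pt j) = 1 ↔ adj i j = true := by
  rw [dist_iff]
  have h1 := r_sq
  have h2 := w_sq
  have h3 : (r * w) * w = 3 / 2 := by linear_combination r * w_sq + r_sq / 2
  have h4 : (r * w) * r = 3 * w := by linear_combination w * r_sq
  have h5 : (r * w) * (r * w) = 3 * r / 2 := by
    linear_combination 3 * w_sq + w * w * r_sq
  have h6 := r_lo
  have h7 := r_hi
  have h8 := w_lo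
  have h9 := w_hi
  have h10 := rw_lo
  have h11 := rw_hi
  fin_cases i <;> first | (exfalso; revert hi; decide) | skip
  all_goals
    fin_cases j <;> first | (exfalso; revert hj; decide) | skip
  all_goals
    first
    | (refine iff_of_true ?_ (by decide)
       simp only [px, py, s, q, v, Fin.mk_one, Fin.zero_eta, Fin.reduceFinMk,
         Matrix.cons_val]
       linarith)
    | (refine iff_of_false ?_ (by decide)
       intro h
       simp only [px, py, s, q, v, Fin.mk_one, Fin.zero_eta, Fin.reduceFinMk,
         Matrix.cons_val] at h
       linarith)

set_option maxHeartbeats 4000000 in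
lemma pt_inj : Function.Injective pt := by
  intro i j h
  have hx : px i = px j := by simpa [pt] using congrArg (fun z => z 0) h
  have hy : py i = py j := by simpa [pt] using congrArg (fun z => z 1) h
  clear h
  have h6 := r_lo
  have h7 := r_hi
  have h8 := w_lo
  have h9 := w_hi
  have h10 := rw_lo
  have h11 := rw_hi
  fin_cases i <;> fin_cases j <;>
    first
    | rfl
    | (exfalso
       simp only [px, py, s, q, v, Fin.mk_one, Fin.zero_eta, Fin.reduceFinMk,
         Matrix.cons_val] at hx hy
       linarith)

end MKaux

open MKaux

open scoped Classical in
theorem isometric_point_circle_realization :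
    ∃ P C : Finset (EuclideanSpace ℝ (Fin 2)),
      Disjoint P C ∧ P.card = 8 ∧ C.card = 8 ∧
      (∀ p ∈ P, (C.filter (fun c => dist p c = 1)).card = 3) ∧
      (∀ c ∈ C, (P.filter (fun p => dist p c = 1)).card = 3) ∧
      Nonempty
        ((SimpleGraph.fromRel (fun x y : ↑(P ∪ C) =>
          (x : EuclideanSpace ℝ (Fin 2)) ∈ P ∧ (y : EuclideanSpace ℝ (Fin 2)) ∈ C ∧
          dist (x : EuclideanSpace ℝ (Fin 2)) (y : EuclideanSpace ℝ (Fin 2)) = 1)) ≃g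
          mobiusKantor) := by
  have hPm : ∀ i, pt i ∈ (Finset.univ.filter (fun i => sd i = true)).image pt ↔ sd i = true := by
    intro i
    simp [pt_inj.eq_iff]
  have hCm : ∀ i, pt i ∈ (Finset.univ.filter (fun i => sd i = false)).image pt ↔ sd i = false := by
    intro i
    simp [pt_inj.eq_iff]
  refine ⟨(Finset.univ.filter (fun i => sd i = true)).image pt,
    (Finset.univ.filter (fun i => sd i = false)).image pt, ?_, ?_, ?_, ?_, ?_, ?_⟩
  · rw [Finset.disjoint_image pt_inj, Finset.disjoint_filter]
    intro i _ h
    simp [h]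
  · rw [Finset.card_image_of_injective _ pt_inj]
    decide
  · rw [Finset.card_image_of_injective _ pt_inj]
    decide
  · intro p hp
    obtain ⟨i, hi, rfl⟩ := Finset.mem_image.1 hp
    have hi' : sd i = true := (Finset.mem_filter.1 hi).2
    rw [Finset.filter_image, Finset.card_image_of_injective _ pt_inj, Finset.filter_filter]
    have : (Finset.univ.filter (fun j => sd j = false ∧ dist (pt i) (pt j) = 1))
        = Finset.univ.filter (fun j => sd j = false ∧ adj i j = true) := by
      apply Finset.filter_congr
      intro j _
      exact and_congr_right fun hj => pt_dist i j hi' hj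
    rw [this]
    clear this hp hi hPm hCm
    have key : ∀ i, sd i = true →
      (Finset.univ.filter (fun j => sd j = false ∧ adj i j = true)).card = 3 := by decide
    convert key i hi'
  · intro p hp
    obtain ⟨i, hi, rfl⟩ := Finset.mem_image.1 hp
    have hi' : sd i = false := (Finset.mem_filter.1 hi).2
    rw [Finset.filter_image, Finset.card_image_of_injective _ pt_inj, Finset.filter_filter]
    have : (Finset.univ.filter (fun j => sd j = true ∧ dist (pt j) (pt i) = 1))
        = Finset.univ.filter (fun j => sd j = true ∧ adj j i = true) := by
      apply Finset.filter_congr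
      intro j _
      exact and_congr_right fun hj => pt_dist j i hj hi'
    rw [this]
    clear this hp hi hPm hCm
    have key : ∀ i, sd i = false →
      (Finset.univ.filter (fun j => sd j = true ∧ adj j i = true)).card = 3 := by decide
    convert key i hi'
  · generalize hP : (Finset.univ.filter (fun i => sd i = true)).image pt = P at *
    generalize hC : (Finset.univ.filter (fun i => sd i = false)).image pt = C at *
    have hmem : ∀ i, pt i ∈ P ∪ C := by
      intro i
      rw [Finset.mem_union, hPm, hCm]
      cases sd i <;> simp
    let f : Fin 16 → ↑(P ∪ C) := fun i => ⟨pt i, hmem i⟩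
    have hf : Function.Bijective f := by
      constructor
      · intro i j h
        exact pt_inj (congrArg Subtype.val h)
      · rintro ⟨x, hx⟩
        have hx' := hx
        rw [Finset.mem_union, ← hP, ← hC, Finset.mem_image, Finset.mem_image] at hx'
        rcases hx' with ⟨i, _, rfl⟩ | ⟨i, _, rfl⟩ <;> exact ⟨i, rfl⟩
    refine ⟨(RelIso.symm ⟨Equiv.ofBijective f hf, ?_⟩)⟩
    intro i j
    rw [mk_adj, SimpleGraph.fromRel_adj]
    change (f i ≠ f j ∧ ((pt i ∈ P ∧ pt j ∈ C ∧ dist (pt i) (pt j) = 1) ∨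
      (pt j ∈ P ∧ pt i ∈ C ∧ dist (pt j) (pt i) = 1))) ↔ _
    rw [hPm, hPm, hCm, hCm]
    constructor
    · rintro ⟨_, ⟨h1, h2, h3⟩ | ⟨h1, h2, h3⟩⟩
      · exact (pt_dist i j h1 h2).1 h3
      · rw [adj_symm]
        exact (pt_dist j i h1 h2).1 h3
    · intro h
      have hs := adj_sd i j h
      refine ⟨fun he => hs (by rw [hf.1 he]), ?_⟩
      cases hi : sd i <;> cases hj : sd j
      · exact absurd (hi.trans hj.symm) hs
      · right
        refine ⟨rfl, rfl, (pt_dist j i hj hi).2 ?_⟩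
        rw [adj_symm]
        exact h
      · left
        exact ⟨rfl, rfl, (pt_dist i j hi hj).2 h⟩
      · exact absurd (hi.trans hj.symm) hs
end
end
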